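/- For every C > 0, the quantity q = q(C) = Σ_{r=1}^{∞} T_r C^{r−1} e^{−Cr}/(r−1)! satisfies the fixed-point relation q = e^{−C(1−q)}. -/

import Mathlib

/-- `treeTerm C s = T_s C^(s-1) e^(-C s) / (s-1)!` where `T_s = s^(s-2)` is the number of
labelled trees on `s` vertices (with `T_1 = 1`, using truncated subtraction). -/
noncomputable def treeTerm (C : ℝ) (s : ℕ) : ℝ :=
  ((s ^ (s - 2) : ℕ) : ℝ) * C ^ (s - 1) * Real.exp (-C * s) / (Nat.factorial (s - 1))

/-- `q(C) = ∑_{s=1}^∞ T_s C^(s-1) e^(-C s)/(s-1)!`. -/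
noncomputable def qfun (C : ℝ) : ℝ := ∑' r : ℕ, treeTerm C (r + 1)

open Finset in
/-- **Abel's binomial identity** in the special case `∑ (m choose j) (j + 1)^(j - 1) (y - j)^(m - j)`,
where the exponent `j - 1` is harmlessly truncated at `j = 0`. -/
theorem abel_binomial_identity (m : ℕ) (y : ℝ) :
    ∑ j ∈ range (m + 1), (m.choose j : ℝ) * ((j : ℝ) + 1) ^ (j - 1) * (y - j) ^ (m - j) =
      (y + 1) ^ m := by
  induction m generalizing y with
  | zero => simp
  | succ m ih =>
    set P : ℝ → ℝ := fun y ↦ ∑ j ∈ range (m + 1 + 1),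
      ((m + 1).choose j : ℝ) * ((j : ℝ) + 1) ^ (j - 1) * (y - j) ^ (m + 1 - j) with hP
    have hderiv (y : ℝ) : HasDerivAt P ((m + 1) * (y + 1) ^ m) y := by
      have h : HasDerivAt P (∑ j ∈ range (m + 1 + 1),
          ((m + 1).choose j : ℝ) * ((j : ℝ) + 1) ^ (j - 1) *
            (((m + 1 - j : ℕ) : ℝ) * (y - j) ^ (m + 1 - j - 1) * 1)) y :=
        HasDerivAt.fun_sum fun j _ ↦
          (((hasDerivAt_id y).sub_const (j : ℝ)).pow (m + 1 - j)).const_mul _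
      refine h.congr_deriv ?_
      symm
      rw [sum_range_succ, ← ih, mul_sum]
      simp only [Nat.sub_self, Nat.cast_zero, zero_mul, mul_zero, add_zero]
      refine sum_congr rfl fun j hj ↦ ?_
      have hj : j ≤ m := by simpa [Nat.lt_succ_iff] using hj
      have hc : ((m + 1).choose j : ℝ) * ((m + 1 - j : ℕ) : ℝ) = (m + 1) * m.choose j := by
        have := Nat.choose_mul_succ_eq m j
        exact_mod_cast (this.symm.trans (mul_comm _ _))
      rw [show m + 1 - j - 1 = m - j by lia]
      linear_combination (-((j : ℝ) + 1) ^ (j - 1) * (y - j) ^ (m - j)) * hc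
    have hroot : P (-1) = 0 := by
      have h := congrFun (fwdDiff_iter_pow_eq_zero_of_lt (R := ℝ) (Nat.lt_succ_self m)) 1
      rw [fwdDiff_iter_eq_sum_shift] at h
      rw [Pi.zero_apply] at h
      rw [← h, hP]
      refine sum_congr rfl fun j hj ↦ ?_
      have hj : j ≤ m + 1 := by simpa [Nat.lt_succ_iff] using hj
      have hpow : ((j : ℝ) + 1) ^ (j - 1) * (j + 1) ^ (m + 1 - j) = (j + 1) ^ m := by
        rcases Nat.eq_zero_or_pos j with rfl | hpos
        · simp
        · rw [← pow_add]
          congr 1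
          lia
      rw [show (-1 - j : ℝ) = (-1) * (j + 1) by ring, mul_pow, zsmul_eq_mul]
      push_cast
      rw [nsmul_one, add_comm (1 : ℝ), ← hpow]
      ring
    have hdiff (y : ℝ) : HasDerivAt (fun y ↦ P y - (y + 1) ^ (m + 1)) 0 y := by
      refine ((hderiv y).sub (((hasDerivAt_id y).add_const 1).pow (m + 1))).congr_deriv ?_
      simp
    have := is_const_of_deriv_eq_zero (fun y ↦ (hdiff y).differentiableAt)
      (fun y ↦ (hdiff y).deriv) y (-1)
    simp only [hroot] at this
    norm_num at this
    linarith

/-- The exponential generating function coefficients `(n + 1)^(n - 1) / n!` of the labelled rooted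
forests on `n` vertices. -/
noncomputable def forestCoeff (n : ℕ) : ℝ := ((n : ℝ) + 1) ^ (n - 1) / n.factorial

theorem forestCoeff_pos (n : ℕ) : 0 < forestCoeff n := by
  unfold forestCoeff
  positivity

theorem forestCoeff_zero : forestCoeff 0 = 1 := by simp [forestCoeff]

theorem forestCoeff_le (n : ℕ) : forestCoeff n ≤ Real.exp 1 ^ (n + 1) := by
  rw [← Real.exp_nat_mul, mul_one]
  refine le_trans ?_ (Real.pow_div_factorial_le_exp (x := ((n + 1 : ℕ) : ℝ)) (by positivity) n)
  unfold forestCoeff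
  push_cast
  gcongr
  · linarith [n.cast_nonneg (α := ℝ)]
  · lia

theorem succ_mul_forestCoeff_succ (m : ℕ) :
    ((m : ℝ) + 1) * forestCoeff (m + 1) =
      ∑ p ∈ Finset.HasAntidiagonal.antidiagonal m, ((p.1 : ℝ) + 1) * forestCoeff p.1 * forestCoeff p.2 := by
  have habel := abel_binomial_identity m (m + 1)
  rw [← Finset.Nat.sum_antidiagonal_eq_sum_range_succ_mk
    (f := fun p : ℕ × ℕ ↦ (m.choose p.1 : ℝ) * ((p.1 : ℝ) + 1) ^ (p.1 - 1) *
      ((m : ℝ) + 1 - p.1) ^ p.2)] at habel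
  rw [← Finset.Nat.sum_antidiagonal_swap] at habel
  have hm : (m.factorial : ℝ) ≠ 0 := by positivity
  have hl : ((m : ℝ) + 1) * forestCoeff (m + 1) = ((m : ℝ) + 1 + 1) ^ m / m.factorial := by
    have : (m : ℝ) + 1 ≠ 0 := by positivity
    rw [forestCoeff, Nat.factorial_succ]
    push_cast
    field_simp
  rw [hl, ← habel, Finset.sum_div]
  refine Finset.sum_congr rfl fun p hp ↦ ?_
  obtain ⟨i, j⟩ := p
  obtain rfl : i + j = m := by simpa using hp
  have hc : ((i + j).choose j : ℝ) = (i + j).factorial / (i.factorial * j.factorial) := by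
    rw [add_comm i j, Nat.cast_add_choose, mul_comm]
  have hi : ((i : ℝ) + 1) * forestCoeff i = ((i : ℝ) + 1) ^ i / i.factorial := by
    rw [forestCoeff, mul_div_assoc', ← pow_succ']
    rcases i with _ | i <;> simp
  rw [hi, forestCoeff]
  simp only [Prod.swap_prod_mk, hc]
  push_cast
  rw [show (i : ℝ) + j + 1 - j = i + 1 by ring]
  field_simp

theorem summable_norm_succ_mul_pow {a : ℕ → ℝ} {K t : ℝ} (ha : ∀ n, |a n| ≤ K) (ht : |t| < 1) :
    Summable fun n : ℕ ↦ ‖((n : ℝ) + 1) * a n * t ^ n‖ := by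
  have h1 := summable_pow_mul_geometric_of_norm_lt_one 1 (r := |t|) (by simpa using ht)
  have h0 := summable_geometric_of_lt_one (abs_nonneg t) ht
  refine Summable.of_nonneg_of_le (fun _ ↦ norm_nonneg _) (fun n ↦ ?_) ((h1.add h0).mul_left K)
  have hn : |(n : ℝ) + 1| = n + 1 := abs_of_nonneg (by positivity)
  rw [Real.norm_eq_abs, abs_mul, abs_mul, abs_pow, hn]
  have := mul_le_mul_of_nonneg_left (ha n) (show 0 ≤ ((n : ℝ) + 1) * |t| ^ n by positivity)
  linarith

theorem summable_norm_mul_pow {a : ℕ → ℝ} {K t : ℝ} (ha : ∀ n, |a n| ≤ K) (ht : |t| < 1) :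
    Summable fun n : ℕ ↦ ‖a n * t ^ n‖ := by
  refine (summable_norm_succ_mul_pow ha ht).of_nonneg_of_le (fun _ ↦ norm_nonneg _) fun n ↦ ?_
  rw [mul_assoc, norm_mul ((n : ℝ) + 1)]
  refine le_mul_of_one_le_left (norm_nonneg _) ?_
  rw [Real.norm_of_nonneg (by positivity)]
  linarith [n.cast_nonneg (α := ℝ)]

/-- Termwise differentiation of a real power series with bounded coefficients. -/
theorem hasDerivAt_tsum_mul_pow {a : ℕ → ℝ} {K t : ℝ} (ha : ∀ n, |a n| ≤ K) (ht : |t| < 1) :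
    HasDerivAt (fun s ↦ ∑' n, a n * s ^ n) (∑' n : ℕ, ((n : ℝ) + 1) * a (n + 1) * t ^ n) t := by
  obtain ⟨ρ, htρ, hρ⟩ := exists_between ht
  have hρ0 : 0 ≤ ρ := (abs_nonneg t).trans htρ.le
  have hρ' : |ρ| < 1 := by rwa [abs_of_nonneg hρ0]
  have hsum : Summable fun n : ℕ ↦ ‖(n : ℝ) * a n * ρ ^ (n - 1)‖ := by
    rw [← summable_nat_add_iff 1]
    simpa using summable_norm_succ_mul_pow (fun n ↦ ha (n + 1)) hρ'
  have hball : t ∈ Metric.ball (0 : ℝ) ρ := by simpa using htρ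
  have hbound (n : ℕ) (y : ℝ) (hy : y ∈ Metric.ball (0 : ℝ) ρ) :
      ‖(n : ℝ) * a n * y ^ (n - 1)‖ ≤ ‖(n : ℝ) * a n * ρ ^ (n - 1)‖ := by
    have hy : |y| ≤ |ρ| := by
      rw [abs_of_nonneg hρ0]
      simpa using (Metric.mem_ball.1 hy).le
    rw [norm_mul, norm_mul _ (ρ ^ _), norm_pow, norm_pow]
    gcongr
    exact hy
  have h := hasDerivAt_tsum_of_isPreconnected (g := fun n s ↦ a n * s ^ n)
    (g' := fun n s ↦ (n : ℝ) * a n * s ^ (n - 1)) hsum Metric.isOpen_ball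
    (convex_ball (0 : ℝ) ρ).isPreconnected
    (fun n y _ ↦ ((hasDerivAt_pow n y).const_mul (a n)).congr_deriv (by ring))
    hbound hball (summable_norm_mul_pow ha ht).of_norm hball
  refine h.congr_deriv ?_
  rw [(Summable.of_norm_bounded hsum fun n ↦ hbound n t hball).tsum_eq_zero_add]
  simp

section

variable {C x : ℝ}

theorem abs_forestCoeff_mul_pow_le (hx : 0 < x) (hxe : x ≤ (Real.exp 1)⁻¹) (n : ℕ) :
    |forestCoeff n * x ^ n| ≤ Real.exp 1 := by
  have hpos := forestCoeff_pos n
  rw [abs_of_nonneg (by positivity)]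
  calc forestCoeff n * x ^ n ≤ Real.exp 1 ^ (n + 1) * (Real.exp 1)⁻¹ ^ n := by
        gcongr
        exact forestCoeff_le n
    _ = Real.exp 1 := by
        rw [pow_succ', mul_assoc, ← mul_pow, mul_inv_cancel₀ (Real.exp_ne_zero 1), one_pow, mul_one]

/-- The functional equation of the forest generating function inside its disc of convergence. -/
theorem tsum_forestCoeff_eq_exp_of_abs_lt_one (hx : 0 < x) (hxe : x ≤ (Real.exp 1)⁻¹) {t : ℝ}
    (ht : |t| < 1) :
    ∑' n, forestCoeff n * x ^ n * t ^ n =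
      Real.exp (x * t * ∑' n, forestCoeff n * x ^ n * t ^ n) := by
  set d : ℕ → ℝ := fun n ↦ forestCoeff n * x ^ n with hd
  have hdK : ∀ n, |d n| ≤ Real.exp 1 := abs_forestCoeff_mul_pow_le hx hxe
  obtain ⟨c, hc0, hcs⟩ : ∃ c : ℕ → ℝ, c 0 = 0 ∧ ∀ n, c (n + 1) = x * d n :=
    ⟨fun n ↦ if n = 0 then 0 else x * d (n - 1), by simp, by simp⟩
  have hcK (n : ℕ) : |c n| ≤ x * Real.exp 1 := by
    rcases n with _ | n
    · rw [hc0, abs_zero]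
      positivity
    · rw [hcs, abs_mul, abs_of_pos hx]
      exact mul_le_mul_of_nonneg_left (hdK n) hx.le
  set g : ℝ → ℝ := fun s ↦ ∑' n, d n * s ^ n with hg
  set f : ℝ → ℝ := fun s ↦ ∑' n, c n * s ^ n with hf
  have hfg {s : ℝ} (hs : |s| < 1) : f s = x * s * g s := by
    simp only [hf, hg]
    rw [(summable_norm_mul_pow hcK hs).of_norm.tsum_eq_zero_add, ← tsum_mul_left]
    simp only [hc0, hcs, zero_mul, zero_add]
    exact tsum_congr fun n ↦ by ring
  have hode {s : ℝ} (hs : |s| < 1) :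
      ∑' n : ℕ, ((n : ℝ) + 1) * d (n + 1) * s ^ n =
        (∑' n : ℕ, ((n : ℝ) + 1) * c (n + 1) * s ^ n) * g s := by
    rw [hg, tsum_mul_tsum_eq_tsum_sum_antidiagonal_of_summable_norm
      (summable_norm_succ_mul_pow (fun n ↦ hcK (n + 1)) hs) (summable_norm_mul_pow hdK hs)]
    refine tsum_congr fun m ↦ ?_
    calc ((m : ℝ) + 1) * d (m + 1) * s ^ m
        = (((m : ℝ) + 1) * forestCoeff (m + 1)) * (x ^ (m + 1) * s ^ m) := by
          simp only [hd]
          ring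
      _ = _ := by
          rw [succ_mul_forestCoeff_succ, Finset.sum_mul]
          refine Finset.sum_congr rfl fun p hp ↦ ?_
          obtain ⟨i, j⟩ := p
          obtain rfl : i + j = m := by simpa using hp
          simp only [hcs, hd]
          ring
  have hder {s : ℝ} (hs : s ∈ Metric.ball (0 : ℝ) 1) :
      HasDerivAt (fun s ↦ g s * Real.exp (-f s)) 0 s := by
    have hs : |s| < 1 := by simpa using hs
    refine ((hasDerivAt_tsum_mul_pow hdK hs).mul
      (hasDerivAt_tsum_mul_pow hcK hs).neg.exp).congr_deriv ?_
    rw [hode hs]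
    simp only [hg, Pi.neg_apply]
    ring
  have hconst : g t * Real.exp (-f t) = g 0 * Real.exp (-f 0) :=
    Metric.isOpen_ball.is_const_of_deriv_eq_zero (convex_ball (0 : ℝ) 1).isPreconnected
      (fun s hs ↦ (hder hs).differentiableAt.differentiableWithinAt)
      (fun s hs ↦ (hder hs).deriv) (by simpa using ht) (by simp)
  have hg0 : g 0 = 1 := by
    simp only [hg]
    rw [tsum_eq_single 0 (by simp +contextual)]
    simp [hd, forestCoeff_zero]
  rw [hg0, hfg (by simp : |(0 : ℝ)| < 1), hfg ht] at hconst
  rw [Real.exp_neg, mul_inv_eq_iff_eq_mul₀ (Real.exp_ne_zero _)] at hconst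
  simpa using hconst

/-- Below the radius of convergence, the rooted tree function is bounded by any `C` with
`x = C * exp (-C)`. -/
theorem mul_tsum_forestCoeff_lt (hC : 0 < C) (hx : x = C * Real.exp (-C))
    (hxe : x ≤ (Real.exp 1)⁻¹) {t : ℝ} (ht0 : 0 ≤ t) (ht : t < 1) :
    x * t * ∑' n, forestCoeff n * x ^ n * t ^ n < C := by
  have hx0 : 0 < x := by rw [hx]; positivity
  have habs {s : ℝ} (hs : s ∈ Set.Icc 0 t) : |s| < 1 := by
    rw [abs_of_nonneg hs.1]
    exact hs.2.trans_lt ht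
  set f : ℝ → ℝ := fun s ↦ x * s * ∑' n, forestCoeff n * x ^ n * s ^ n with hf
  have hcont : ContinuousOn f (Set.Icc 0 t) := by
    refine ContinuousOn.mul (by fun_prop) fun s hs ↦ ?_
    exact (hasDerivAt_tsum_mul_pow (abs_forestCoeff_mul_pow_le hx0 hxe)
      (habs hs)).continuousAt.continuousWithinAt
  by_contra! hle
  obtain ⟨s, hs, hsC⟩ := intermediate_value_Icc ht0 hcont ⟨by simpa [hf] using hC.le, hle⟩
  have hfix := tsum_forestCoeff_eq_exp_of_abs_lt_one hx0 hxe (habs hs)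
  have hs1 : s < 1 := hs.2.trans_lt ht
  simp only [hf] at hsC
  rw [hsC] at hfix
  rw [hfix, hx, Real.exp_neg] at hsC
  field_simp at hsC
  linarith

theorem summable_forestCoeff_mul_pow (hC : 0 < C) (hx : x = C * Real.exp (-C))
    (hxe : x ≤ (Real.exp 1)⁻¹) : Summable fun n ↦ forestCoeff n * x ^ n := by
  have hx0 : 0 < x := by rw [hx]; positivity
  have hnonneg (n : ℕ) : 0 ≤ forestCoeff n * x ^ n :=
    mul_nonneg (forestCoeff_pos n).le (pow_nonneg hx0.le n)
  refine summable_of_sum_range_le (c := C / x) hnonneg fun N ↦ ?_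
  rw [le_div_iff₀' hx0]
  have hcont : Continuous fun t : ℝ ↦
      x * t * ∑ n ∈ Finset.range N, forestCoeff n * x ^ n * t ^ n := by fun_prop
  have hlim := (hcont.tendsto 1).mono_left (nhdsWithin_le_nhds (s := Set.Iio 1))
  simp only [mul_one, one_pow] at hlim
  refine le_of_tendsto hlim ?_
  filter_upwards [Ioo_mem_nhdsLT (zero_lt_one' ℝ)] with t ht
  refine le_trans ?_ (mul_tsum_forestCoeff_lt hC hx hxe ht.1.le ht.2).le
  refine mul_le_mul_of_nonneg_left ?_ (mul_nonneg hx0.le ht.1.le)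
  refine Summable.sum_le_tsum _ (fun n _ ↦ mul_nonneg (hnonneg n) (pow_nonneg ht.1.le n)) ?_
  exact (summable_norm_mul_pow (abs_forestCoeff_mul_pow_le hx0 hxe)
    (by rw [abs_of_pos ht.1]; exact ht.2)).of_norm

/-- The functional equation of the forest generating function, up to the boundary. -/
theorem tsum_forestCoeff_eq_exp (hC : 0 < C) (hx : x = C * Real.exp (-C))
    (hxe : x ≤ (Real.exp 1)⁻¹) :
    ∑' n, forestCoeff n * x ^ n = Real.exp (x * ∑' n, forestCoeff n * x ^ n) := by
  have hx0 : 0 < x := by rw [hx]; positivity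
  have hnonneg (n : ℕ) : 0 ≤ forestCoeff n * x ^ n :=
    mul_nonneg (forestCoeff_pos n).le (pow_nonneg hx0.le n)
  have hcont : ContinuousOn (fun t : ℝ ↦ ∑' n, forestCoeff n * x ^ n * t ^ n) (Set.Icc 0 1) := by
    refine continuousOn_tsum (fun n ↦ by fun_prop) (summable_forestCoeff_mul_pow hC hx hxe)
      fun n t ht ↦ ?_
    rw [Real.norm_of_nonneg (mul_nonneg (hnonneg n) (pow_nonneg ht.1 n))]
    exact mul_le_of_le_one_right (hnonneg n) (pow_le_one₀ ht.1 ht.2)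
  have hright : ContinuousOn
      (fun t : ℝ ↦ Real.exp (x * t * ∑' n, forestCoeff n * x ^ n * t ^ n)) (Set.Icc 0 1) :=
    (ContinuousOn.mul (by fun_prop) hcont).rexp
  have heq : Set.EqOn (fun t : ℝ ↦ ∑' n, forestCoeff n * x ^ n * t ^ n)
      (fun t : ℝ ↦ Real.exp (x * t * ∑' n, forestCoeff n * x ^ n * t ^ n)) (Set.Ico 0 1) := by
    intro t ht
    exact tsum_forestCoeff_eq_exp_of_abs_lt_one hx0 hxe
      (by rw [abs_of_nonneg ht.1]; exact ht.2)
  have h := heq.of_subset_closure hcont hright Set.Ico_subset_Icc_self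
    (closure_Ico (zero_ne_one' ℝ)).ge (Set.right_mem_Icc.2 zero_le_one)
  simpa using h

end

theorem treeTerm_succ (C : ℝ) (n : ℕ) :
    treeTerm C (n + 1) = Real.exp (-C) * (forestCoeff n * (C * Real.exp (-C)) ^ n) := by
  have hexp : Real.exp (-C * ((n + 1 : ℕ) : ℝ)) = Real.exp (-C) * Real.exp (-C) ^ n := by
    rw [← pow_succ', ← Real.exp_nat_mul, mul_comm]
  rw [treeTerm, hexp, forestCoeff, show n + 1 - 2 = n - 1 by lia, Nat.add_sub_cancel]
  push_cast
  ring

/-- For every `C > 0`, `q = q(C)` satisfies the fixed point relation `q = e^(-C(1-q))`. -/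
theorem qfun_fixed_point (C : ℝ) (hC : 0 < C) :
    qfun C = Real.exp (-C * (1 - qfun C)) := by
  have hxe : C * Real.exp (-C) ≤ (Real.exp 1)⁻¹ := by
    have h := Real.add_one_le_exp (C - 1)
    rw [sub_add_cancel] at h
    calc C * Real.exp (-C) ≤ Real.exp (C - 1) * Real.exp (-C) := by gcongr
      _ = (Real.exp 1)⁻¹ := by
        rw [← Real.exp_add, ← Real.exp_neg]
        congr 1
        ring
  have hq : qfun C = Real.exp (-C) * ∑' n, forestCoeff n * (C * Real.exp (-C)) ^ n := by
    simp only [qfun, treeTerm_succ, tsum_mul_left]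
  have hfix := tsum_forestCoeff_eq_exp hC rfl hxe
  rw [mul_assoc, ← hq] at hfix
  rw [hfix, ← Real.exp_add] at hq
  rw [show -C * (1 - qfun C) = -C + C * qfun C by ring]
  exact hq
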